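/- arXiv:2110.09068 — 2 statements merged into one kernel-verified Lean document; each statement's English description precedes it below -/
import Mathlib

section
/- For all fixed reals 0 < α < 1/2 and 0 < ρ < 1 there exists n₁ ∈ ℕ such that for every n ≥ n₁, every integer r with 2 ≤ r ≤ (1−ρ)n, every (α,r)-near-regular degree sequence d ∈ ℕⁿ, every graph G ∈ G(d), and every pair of distinct vertices u, v with {u,v} ∉ E(G), there exists a graph G' ∈ G(d) with {u,v} ∈ E(G') and |E(G) △ E(G')| ≤ 12, where △ denotes symmetric difference of edge sets. -/
/-- The degree of vertex `i` in a simple graph on `Fin n`. -/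
noncomputable def degOf {n : ℕ} (G : SimpleGraph (Fin n)) (i : Fin n) : ℕ :=
  (G.neighborSet i).ncard

/-- `Gd n d` is the set of graphs on `[n]` with degree sequence `d`. -/
def Gd (n : ℕ) (d : Fin n → ℕ) : Set (SimpleGraph (Fin n)) :=
  {G | ∀ i, degOf G i = d i}

open Classical in
theorem degOf_eq_card_filter_edgeFinset {n : ℕ} (G : SimpleGraph (Fin n)) (i : Fin n) :
    degOf G i = (G.edgeFinset.filter (i ∈ ·)).card := by
  rw [← SimpleGraph.incidenceFinset_eq_filter, SimpleGraph.card_incidenceFinset_eq_degree,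
    ← SimpleGraph.card_neighborFinset_eq_degree, SimpleGraph.neighborFinset,
    degOf, Set.ncard_eq_toFinset_card']

open Classical in
/-- Replacing the edges `R` by the non-edges `A` preserves all degrees as soon as `R` and `A`
cover each vertex equally often. -/
theorem exists_switch {n : ℕ} (G : SimpleGraph (Fin n)) (R A : Finset (Sym2 (Fin n)))
    (hR : R ⊆ G.edgeFinset) (hA : Disjoint A G.edgeFinset) (hdiag : ∀ e ∈ A, ¬ e.IsDiag)
    (hcover : ∀ i : Fin n, (R.filter (i ∈ ·)).card = (A.filter (i ∈ ·)).card) :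
    ∃ G' : SimpleGraph (Fin n), (∀ i, degOf G' i = degOf G i) ∧ (∀ e ∈ A, e ∈ G'.edgeSet) ∧
      (symmDiff G.edgeSet G'.edgeSet).ncard ≤ R.card + A.card := by
  let E : Finset (Sym2 (Fin n)) := G.edgeFinset \ R ∪ A
  have hE : (SimpleGraph.fromEdgeSet (E : Set (Sym2 (Fin n)))).edgeSet = E := by
    rw [SimpleGraph.edgeSet_fromEdgeSet, sdiff_eq_left, Set.disjoint_left]
    intro e he hd
    rcases Finset.mem_union.1 (Finset.mem_coe.1 he) with h | h
    · exact G.not_isDiag_of_mem_edgeFinset (Finset.mem_sdiff.1 h).1 hd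
    · exact hdiag e h hd
  have hE' (inst : Fintype (SimpleGraph.fromEdgeSet (E : Set (Sym2 (Fin n)))).edgeSet) :
      @SimpleGraph.edgeFinset _ (SimpleGraph.fromEdgeSet (E : Set (Sym2 (Fin n)))) inst = E := by
    ext e; rw [SimpleGraph.mem_edgeFinset, hE, Finset.mem_coe]
  refine ⟨SimpleGraph.fromEdgeSet (E : Set (Sym2 (Fin n))), fun i => ?_, fun e he => ?_, ?_⟩
  · rw [degOf_eq_card_filter_edgeFinset, degOf_eq_card_filter_edgeFinset, hE',
      Finset.filter_union, Finset.card_union_of_disjoint, ← hcover,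
      ← Finset.card_union_of_disjoint, ← Finset.filter_union, Finset.sdiff_union_of_subset hR]
    · exact Finset.disjoint_filter_filter Finset.sdiff_disjoint
    · exact Finset.disjoint_filter_filter (hA.mono_right Finset.sdiff_subset).symm
  · rw [hE]
    exact Finset.mem_coe.2 (Finset.mem_union_right _ he)
  · rw [hE]
    refine (Set.ncard_le_ncard (t := ((R ∪ A : Finset _) : Set (Sym2 (Fin n)))) ?_
      (Finset.finite_toSet _)).trans ?_
    · intro e he
      simp only [E, Set.mem_symmDiff, Finset.coe_union, Set.mem_union, Finset.mem_coe,
        Finset.mem_sdiff, SimpleGraph.mem_edgeFinset] at he ⊢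
      tauto
    · rw [Set.ncard_coe_finset]
      exact Finset.card_union_le _ _

theorem Sym2.indicator_mem_mk {V : Type*} [DecidableEq V] {p q : V} (h : p ≠ q) (i : V) :
    (if i ∈ s(p, q) then 1 else 0 : ℕ) = (if i = p then 1 else 0) + (if i = q then 1 else 0) := by
  simp only [Sym2.mem_iff]
  by_cases hp : i = p <;> by_cases hq : i = q <;> simp_all

/-- Switching along an alternating closed trail of length four. -/
theorem exists_switch_four {n : ℕ} {G : SimpleGraph (Fin n)} {u v x y : Fin n} (huv : u ≠ v)
    (hn : ¬ G.Adj u v) (hx : G.Adj u x) (hy : G.Adj v y) (hxy : x ≠ y) (hna : ¬ G.Adj x y) :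
    ∃ G' : SimpleGraph (Fin n), (∀ i, degOf G' i = degOf G i) ∧ G'.Adj u v ∧
      (symmDiff G.edgeSet G'.edgeSet).ncard ≤ 12 := by
  classical
  have hyu : y ≠ u := by rintro rfl; exact hn hy.symm
  have h1 : s(u, x) ∉ ({s(v, y)} : Finset (Sym2 (Fin n))) := by
    simp [huv, hyu.symm]
  have h2 : s(u, v) ∉ ({s(x, y)} : Finset (Sym2 (Fin n))) := by
    simp [hx.ne, hyu.symm]
  obtain ⟨G', hdeg, hadj, hcard⟩ := exists_switch G {s(u, x), s(v, y)} {s(u, v), s(x, y)}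
    (by simp [Finset.insert_subset_iff, hx, hy])
    (by simp [Finset.disjoint_left, hn, hna])
    (by simp [huv, hxy])
    (by
      intro i
      simp only [Finset.card_filter, Finset.sum_insert h1, Finset.sum_insert h2,
        Finset.sum_singleton, Sym2.indicator_mem_mk hx.ne, Sym2.indicator_mem_mk hy.ne,
        Sym2.indicator_mem_mk huv, Sym2.indicator_mem_mk hxy]
      ring)
  refine ⟨G', hdeg, hadj s(u, v) (by simp), hcard.trans ?_⟩
  rw [Finset.card_insert_of_notMem h1, Finset.card_insert_of_notMem h2]
  simp

/-- Switching along an alternating closed trail of length six. -/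
theorem exists_switch_six {n : ℕ} {G : SimpleGraph (Fin n)} {u v x y a b : Fin n} (huv : u ≠ v)
    (hn : ¬ G.Adj u v) (hx : G.Adj u x) (hy : G.Adj v y) (hxy : x ≠ y → G.Adj x y)
    (hax : a ≠ x) (hna : ¬ G.Adj a x) (hby : b ≠ y) (hnb : ¬ G.Adj b y) (hab : G.Adj a b) :
    ∃ G' : SimpleGraph (Fin n), (∀ i, degOf G' i = degOf G i) ∧ G'.Adj u v ∧
      (symmDiff G.edgeSet G'.edgeSet).ncard ≤ 12 := by
  classical
  have hyu : y ≠ u := by rintro rfl; exact hn hy.symm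
  have hau : a ≠ u := by rintro rfl; exact hna hx
  have hbv : b ≠ v := by rintro rfl; exact hnb hy
  have hay : ¬ (a = y ∧ x = b) := by
    rintro ⟨rfl, rfl⟩
    exact hna (hxy hax.symm).symm
  have h1 : s(u, x) ∉ ({s(v, y), s(a, b)} : Finset (Sym2 (Fin n))) := by
    simp [huv, hyu.symm, hau.symm, hax.symm]
  have h1' : s(v, y) ∉ ({s(a, b)} : Finset (Sym2 (Fin n))) := by
    simp [hbv.symm, hby.symm]
  have h2 : s(u, v) ∉ ({s(a, x), s(b, y)} : Finset (Sym2 (Fin n))) := by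
    simp [hx.ne, hyu.symm, hau.symm, hy.ne]
  have h2' : s(a, x) ∉ ({s(b, y)} : Finset (Sym2 (Fin n))) := by
    simp only [Finset.mem_singleton, Sym2.eq_iff, hab.ne, false_and, false_or]
    exact hay
  obtain ⟨G', hdeg, hadj, hcard⟩ := exists_switch G {s(u, x), s(v, y), s(a, b)}
    {s(u, v), s(a, x), s(b, y)}
    (by simp [Finset.insert_subset_iff, hx, hy, hab])
    (by simp [Finset.disjoint_left, hn, hna, hnb])
    (by simp [huv, hax, hby])
    (by
      intro i
      simp only [Finset.card_filter, Finset.sum_insert h1, Finset.sum_insert h2,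
        Finset.sum_insert h1', Finset.sum_insert h2',
        Finset.sum_singleton, Sym2.indicator_mem_mk hx.ne, Sym2.indicator_mem_mk hy.ne,
        Sym2.indicator_mem_mk huv, Sym2.indicator_mem_mk hax, Sym2.indicator_mem_mk hby,
        Sym2.indicator_mem_mk hab.ne]
      ring)
  refine ⟨G', hdeg, hadj s(u, v) (by simp), hcard.trans ?_⟩
  rw [Finset.card_insert_of_notMem h1, Finset.card_insert_of_notMem h2,
    Finset.card_insert_of_notMem h1', Finset.card_insert_of_notMem h2']
  simp

open Finset in
/-- If the degrees lie in `[δ, Δ]` and this interval is short enough, then any non-edge can be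
added by a switch of length at most six. -/
theorem exists_switch_of_degree_bounds {n : ℕ} (G : SimpleGraph (Fin n)) (δ Δ : ℕ) (hδ : 0 < δ)
    (hlow : ∀ i, δ ≤ degOf G i) (hup : ∀ i, degOf G i ≤ Δ)
    (hlt : (Δ + 1) * (Δ + 1 - δ) < (n - (Δ + 1)) * δ)
    {u v : Fin n} (huv : u ≠ v) (hn : ¬ G.Adj u v) :
    ∃ G' : SimpleGraph (Fin n), (∀ i, degOf G' i = degOf G i) ∧ G'.Adj u v ∧
      (symmDiff G.edgeSet G'.edgeSet).ncard ≤ 12 := by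
  classical
  by_contra hno
  let N : Fin n → Finset (Fin n) := fun i => univ.filter (G.Adj i)
  have hN : ∀ i, (N i).card = degOf G i := by
    intro i
    rw [degOf, ← Set.ncard_coe_finset]
    congr 1
    ext j
    simp [N]
  have hfour : ∀ x y, G.Adj u x → G.Adj v y → x ≠ y → G.Adj x y := by
    intro x y hx hy hxy
    by_contra h
    exact hno (exists_switch_four huv hn hx hy hxy h)
  let W : Finset (Fin n) := univ.filter fun a => ∀ x, G.Adj u x → a ≠ x → G.Adj a x
  let B : Finset (Fin n) := univ.filter fun b => ∃ y, G.Adj v y ∧ b ≠ y ∧ ¬ G.Adj b y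
  have hBW : ∀ b ∈ B, ∀ a, G.Adj a b → a ∈ W := by
    intro b hb a hab
    obtain ⟨y, hy, hby, hnb⟩ := (mem_filter.1 hb).2
    refine mem_filter.2 ⟨mem_univ _, fun x hx hax => ?_⟩
    by_contra hna
    exact hno (exists_switch_six huv hn hx hy (hfour x y hx hy) hax hna hby hnb hab)
  have hnonempty : ∀ i, ∃ x, G.Adj i x := by
    intro i
    obtain ⟨x, hx⟩ := card_pos.1 ((hN i).symm ▸ hδ.trans_le (hlow i))
    exact ⟨x, (mem_filter.1 hx).2⟩
  have hW : W.card ≤ Δ + 1 := by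
    obtain ⟨x, hx⟩ := hnonempty u
    calc W.card ≤ (insert x (N x)).card := by
          refine card_le_card fun a ha => ?_
          by_cases h : a = x
          · exact mem_insert.2 (Or.inl h)
          · exact mem_insert_of_mem
              (mem_filter.2 ⟨mem_univ _, ((mem_filter.1 ha).2 x hx h).symm⟩)
      _ ≤ (N x).card + 1 := card_insert_le _ _
      _ ≤ Δ + 1 := by rw [hN]; exact Nat.succ_le_succ (hup x)
  have hB : n - (Δ + 1) ≤ B.card := by
    obtain ⟨y, hy⟩ := hnonempty v
    have h1 : (insert y (N y)).card ≤ Δ + 1 :=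
      (card_insert_le _ _).trans (by rw [hN]; exact Nat.succ_le_succ (hup y))
    have h2 : (insert y (N y))ᶜ ⊆ B := by
      intro b hb
      simp only [mem_compl, mem_insert, not_or, N, mem_filter, mem_univ, true_and] at hb
      exact mem_filter.2 ⟨mem_univ _, y, hy, hb.1, fun h => hb.2 h.symm⟩
    have h3 := card_le_card h2
    rw [card_compl, Fintype.card_fin] at h3
    omega
  have hcount := sum_card_bipartiteAbove_eq_sum_card_bipartiteBelow (s := W) (t := B) G.Adj
  have hlower : B.card * δ ≤ ∑ b ∈ B, (bipartiteBelow G.Adj W b).card := by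
    rw [← smul_eq_mul]
    refine card_nsmul_le_sum _ _ _ fun b hb => (hlow b).trans ?_
    rw [← hN]
    refine card_le_card fun a ha => ?_
    have hba : G.Adj b a := (mem_filter.1 ha).2
    exact (mem_bipartiteBelow _).2 ⟨hBW b hb a hba.symm, hba.symm⟩
  have hupper : ∑ w ∈ W, (bipartiteAbove G.Adj B w).card ≤ W.card * (Δ + 1 - δ) := by
    rw [← smul_eq_mul]
    refine sum_le_card_nsmul _ _ _ fun w hw => ?_
    have hdisj : Disjoint (bipartiteAbove G.Adj B w) ((N u).erase w) := by
      rw [disjoint_left]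
      intro z hz hzu
      obtain ⟨y, hy, hzy, hnz⟩ := (mem_filter.1 ((mem_bipartiteAbove _).1 hz).1).2
      exact hnz (hfour z y (mem_filter.1 (mem_of_mem_erase hzu)).2 hy hzy)
    have hsub : bipartiteAbove G.Adj B w ∪ (N u).erase w ⊆ N w := by
      intro z hz
      refine mem_filter.2 ⟨mem_univ _, ?_⟩
      rcases mem_union.1 hz with h | h
      · exact ((mem_bipartiteAbove _).1 h).2
      · exact (mem_filter.1 hw).2 z (mem_filter.1 (mem_of_mem_erase h)).2 (ne_of_mem_erase h).symm
    have h1 := card_le_card hsub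
    rw [card_union_of_disjoint hdisj, hN] at h1
    have h2 := pred_card_le_card_erase (s := N u) (a := w)
    rw [hN] at h2
    have h3 := hup w
    have h4 := hlow u
    omega
  have h1 : (n - (Δ + 1)) * δ ≤ B.card * δ := Nat.mul_le_mul_right _ hB
  have h2 : W.card * (Δ + 1 - δ) ≤ (Δ + 1) * (Δ + 1 - δ) := Nat.mul_le_mul_right _ hW
  omega

/-- For near-regular degree sequences: any non-edge of a realization can be added while
staying within symmetric difference `12` of the original realization. -/
theorem add_edge_close_realization (α ρ : ℝ) (hα0 : 0 < α) (hα : α < 1 / 2)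
    (hρ0 : 0 < ρ) (hρ : ρ < 1) :
    ∃ n₁ : ℕ, ∀ n : ℕ, n₁ ≤ n → ∀ r : ℕ, 2 ≤ r → (r : ℝ) ≤ (1 - ρ) * n →
      ∀ d : Fin n → ℕ, (∀ i, |(d i : ℝ) - (r : ℝ)| ≤ (r : ℝ) ^ α) →
        ∀ G ∈ Gd n d, ∀ u v : Fin n, u ≠ v → ¬ G.Adj u v →
          ∃ G' ∈ Gd n d, G'.Adj u v ∧ (symmDiff G.edgeSet G'.edgeSet).ncard ≤ 12 := by
  refine ⟨⌈625 / ρ ^ 2 + 26 / ρ⌉₊ + 1, fun n hn r hr hrn d hd G hG u v huv hnadj => ?_⟩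
  have hnlarge : 625 / ρ ^ 2 + 26 / ρ < n :=
    (Nat.le_ceil _).trans_lt (by exact_mod_cast Nat.lt_of_succ_le hn)
  have hrpow : (r : ℝ) ^ α ≤ √(r : ℝ) := by
    rw [Real.sqrt_eq_rpow]
    exact Real.rpow_le_rpow_of_exponent_le (by exact_mod_cast (by omega : 1 ≤ r)) hα.le
  obtain ⟨s, hs⟩ : ∃ s, s = Nat.sqrt r := ⟨_, rfl⟩
  have hsr : s * s ≤ r := hs ▸ Nat.sqrt_le r
  have hdist : ∀ m : ℕ, (m : ℝ) ≤ (r : ℝ) ^ α → m ≤ s := by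
    intro m hm
    rw [hs, Nat.le_sqrt]
    have := (Real.le_sqrt (Nat.cast_nonneg m) (Nat.cast_nonneg r)).1 (hm.trans hrpow)
    rw [← sq]
    exact_mod_cast this
  have hdlow : ∀ i, r - s ≤ d i := by
    intro i
    rcases le_total r (d i) with h | h
    · omega
    · have := hdist (r - d i) (by
        rw [Nat.cast_sub h]; exact (neg_sub (d i : ℝ) r ▸ neg_le_abs _).trans (hd i))
      omega
  have hdup : ∀ i, d i ≤ r + s := by
    intro i
    rcases le_total (d i) r with h | h
    · omega
    · have := hdist (d i - r) (by
        rw [Nat.cast_sub h]; exact (le_abs_self _).trans (hd i))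
      omega
  have h4s : 4 * s ≤ 3 * r := by
    rcases Nat.lt_or_ge s 2 with h | h
    · omega
    · nlinarith
  have hsr' : (s : ℝ) * s ≤ r := by exact_mod_cast hsr
  have hr' : (2 : ℝ) ≤ r := by exact_mod_cast hr
  have hmain : 25 * (s : ℝ) + 13 < ρ * n := by
    have hsn : (s : ℝ) * s ≤ n := by nlinarith [Nat.cast_nonneg (α := ℝ) n]
    have h1 : 625 + 26 * ρ < ρ ^ 2 * n := by
      have := mul_lt_mul_of_pos_left hnlarge (pow_pos hρ0 2)
      have e : ρ ^ 2 * (625 / ρ ^ 2 + 26 / ρ) = 625 + 26 * ρ := by field_simp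
      rwa [e] at this
    have h2 : ρ * (25 * s + 13) < ρ * (ρ * n) := by
      nlinarith [sq_nonneg (ρ * s - 25), mul_le_mul_of_nonneg_left hsn (sq_nonneg ρ)]
    exact lt_of_mul_lt_mul_left h2 hρ0.le
  have hgap : (13 + 25 * s : ℝ) < n - r := by nlinarith
  have hgap' : 13 + 25 * s + r < n := by
    have : (13 + 25 * s + r : ℝ) < n := by linarith
    exact_mod_cast this
  have hlt : (r + s + 1) * (r + s + 1 - (r - s)) < (n - (r + s + 1)) * (r - s) := by
    have e1 : r + s + 1 - (r - s) = 2 * s + 1 := by omega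
    have h1 : 12 * (2 * s + 1) < n - (r + s + 1) := by omega
    have h2 : r ≤ 4 * (r - s) := by omega
    have h3 : r + s + 1 ≤ 12 * (r - s) := by omega
    rw [e1]
    calc (r + s + 1) * (2 * s + 1) ≤ 12 * (r - s) * (2 * s + 1) := Nat.mul_le_mul_right _ h3
      _ = 12 * (2 * s + 1) * (r - s) := by ring
      _ < (n - (r + s + 1)) * (r - s) := Nat.mul_lt_mul_of_pos_right h1 (by omega)
  obtain ⟨G', hdeg, hadj, hcard⟩ := exists_switch_of_degree_bounds G (r - s) (r + s) (by omega)
    (fun i => (hG i).symm ▸ hdlow i) (fun i => (hG i).symm ▸ hdup i) hlt huv hnadj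
  exact ⟨G', fun i => (hdeg i).trans (hG i), hadj, hcard⟩
end

section
/- For all fixed reals 0 < α < 1/2 and 0 < ρ < 1 there exists n₀ ∈ ℕ such that the following holds for every n ≥ n₀, every integer r with 2 ≤ r ≤ (1−ρ)n, every (α,r)-near-regular degree sequence d ∈ ℕⁿ, and all distinct vertices a, b in [n]: defining H = {G ∈ G(d) : ∃ c ∉ {a,b} with {b,c} ∈ E(G) and {a,c} ∉ E(G)}, one has n¹² · |H| ≥ |G(d)|. -/
/-- `H`: realizations of `d` admitting a hinge flip moving an edge from `b` to `a`. -/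
def Hset (n : ℕ) (d : Fin n → ℕ) (a b : Fin n) : Set (SimpleGraph (Fin n)) :=
  {G | G ∈ Gd n d ∧ ∃ c : Fin n, c ≠ a ∧ c ≠ b ∧ G.Adj b c ∧ ¬ G.Adj a c}

/-- The symmetric difference of `G` with the closed walk `q p x y`; when `pq`, `xy` are edges and
`px`, `qy` are not, this replaces the former two edges by the latter two. -/
def switch {V : Type*} (G : SimpleGraph V) (p q x y : V) : SimpleGraph V :=
  symmDiff G (SimpleGraph.fromEdgeSet {s(p, q), s(x, y), s(p, x), s(q, y)})

lemma switch_switch {V : Type*} (G : SimpleGraph V) (p q x y : V) :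
    switch (switch G p q x y) p q x y = G := by
  simp [switch]

lemma switch_self {V : Type*} (G : SimpleGraph V) (p : V) : switch G p p p p = G := by
  ext u v
  simp only [switch, symmDiff_def, SimpleGraph.sup_adj, SimpleGraph.sdiff_adj,
    SimpleGraph.fromEdgeSet_adj, Set.mem_insert_iff, Set.mem_singleton_iff, Sym2.eq_iff]
  grind

lemma switch_adj {V : Type*} (G : SimpleGraph V) (p q x y u v : V) :
    (switch G p q x y).Adj u v ↔
      ((G.Adj u v ∧ ¬ (s(u, v) = s(p, q) ∨ s(u, v) = s(x, y) ∨ s(u, v) = s(p, x) ∨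
          s(u, v) = s(q, y))) ∨
        (u ≠ v ∧ ¬ G.Adj u v ∧ (s(u, v) = s(p, q) ∨ s(u, v) = s(x, y) ∨ s(u, v) = s(p, x) ∨
          s(u, v) = s(q, y)))) := by
  have : G.Adj u v → u ≠ v := fun h => h.ne
  simp only [switch, symmDiff_def, SimpleGraph.sup_adj, SimpleGraph.sdiff_adj,
    SimpleGraph.fromEdgeSet_adj, Set.mem_insert_iff, Set.mem_singleton_iff]
  tauto

lemma degOf_switch {n : ℕ} {G : SimpleGraph (Fin n)} {p q x y : Fin n}
    (hpq : G.Adj p q) (hxy : G.Adj x y) (hpx : ¬ G.Adj p x) (hqy : ¬ G.Adj q y)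
    (hpx' : p ≠ x) (hqy' : q ≠ y) (v : Fin n) :
    degOf (switch G p q x y) v = degOf G v := by
  have hpy : p ≠ y := by rintro rfl; exact hpx hxy.symm
  have hqx : q ≠ x := by rintro rfl; exact hpx hpq
  have h1 := hpq.ne
  have h2 := hxy.ne
  have hqp := hpq.symm
  have hyx := hxy.symm
  have hxp : ¬ G.Adj x p := fun h => hpx h.symm
  have hyq : ¬ G.Adj y q := fun h => hqy h.symm
  have exchange : ∀ s t : Fin n, s ∉ G.neighborSet v → t ∈ G.neighborSet v →
      (switch G p q x y).neighborSet v = insert s (G.neighborSet v \ {t}) →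
      degOf (switch G p q x y) v = degOf G v := by
    intro s t hs ht h
    rw [degOf, degOf, h, Set.ncard_exchange hs ht]
  by_cases hvp : v = p
  · subst hvp
    refine exchange x q hpx hpq ?_
    ext w
    simp only [SimpleGraph.mem_neighborSet, switch_adj, Sym2.eq_iff, Set.mem_insert_iff,
      Set.mem_sdiff, Set.mem_singleton_iff]
    grind
  by_cases hvq : v = q
  · subst hvq
    refine exchange y p hqy hqp ?_
    ext w
    simp only [SimpleGraph.mem_neighborSet, switch_adj, Sym2.eq_iff, Set.mem_insert_iff,
      Set.mem_sdiff, Set.mem_singleton_iff]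
    grind
  by_cases hvx : v = x
  · subst hvx
    refine exchange p y hxp hxy ?_
    ext w
    simp only [SimpleGraph.mem_neighborSet, switch_adj, Sym2.eq_iff, Set.mem_insert_iff,
      Set.mem_sdiff, Set.mem_singleton_iff]
    grind
  by_cases hvy : v = y
  · subst hvy
    refine exchange q x hyq hyx ?_
    ext w
    simp only [SimpleGraph.mem_neighborSet, switch_adj, Sym2.eq_iff, Set.mem_insert_iff,
      Set.mem_sdiff, Set.mem_singleton_iff]
    grind
  · unfold degOf
    congr 1
    ext w
    simp only [SimpleGraph.mem_neighborSet, switch_adj, Sym2.eq_iff]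
    grind

lemma degOf_eq_degree {n : ℕ} (G : SimpleGraph (Fin n)) [DecidableRel G.Adj] (v : Fin n) :
    degOf G v = G.degree v := by
  rw [degOf, ← SimpleGraph.card_neighborFinset_eq_degree, SimpleGraph.neighborFinset,
    Set.ncard_eq_toFinset_card']

section Counting

variable {V : Type*} [Fintype V] [DecidableEq V] {G : SimpleGraph V} [DecidableRel G.Adj]

/-- If the neighbours of every non-neighbour of `a` are neighbours of `a`, then `a` has few
non-neighbours. -/
lemma card_nonneighbors_mul_le {r k : ℕ} {a : V}
    (hlow : ∀ v, r ≤ G.degree v + k) (hup : ∀ v, G.degree v ≤ r + k)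
    (h : ∀ x y, x ≠ a → ¬ G.Adj a x → G.Adj x y → G.Adj a y) :
    (insert a (G.neighborFinset a))ᶜ.card * (r - k) ≤ (r + k) * (r + k) := by
  refine (Finset.card_mul_le_card_mul G.Adj (s := (insert a (G.neighborFinset a))ᶜ)
    (t := G.neighborFinset a) (m := r - k) (n := r + k) ?_ ?_).trans ?_
  · intro x hx
    simp only [Finset.mem_compl, Finset.mem_insert, SimpleGraph.mem_neighborFinset, not_or] at hx
    have hsub : G.neighborFinset x ⊆ Finset.bipartiteAbove G.Adj (G.neighborFinset a) x := by
      intro y hy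
      simp only [SimpleGraph.mem_neighborFinset] at hy
      simp [Finset.mem_bipartiteAbove, hy, h x y hx.1 hx.2 hy]
    have := Finset.card_le_card hsub
    rw [SimpleGraph.card_neighborFinset_eq_degree] at this
    have := hlow x
    omega
  · intro y _
    refine le_trans (Finset.card_le_card ?_) (hup y)
    intro x hx
    simp only [Finset.mem_bipartiteBelow] at hx
    simpa using hx.2.symm
  · rw [SimpleGraph.card_neighborFinset_eq_degree]
    gcongr
    exact hup a

/-- If every neighbour `c ≠ a` of `b` is adjacent to `a` and dominates all neighbours of
non-neighbours of `a`, then `a` has few non-neighbours. -/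
lemma card_nonneighbors_mul_le_of_dominating {r k : ℕ} {a b c₀ : V}
    (hlow : ∀ v, r ≤ G.degree v + k) (hup : ∀ v, G.degree v ≤ r + k)
    (hc₀ : G.Adj b c₀) (hc₀a : c₀ ≠ a)
    (hsub : ∀ c, c ≠ a → G.Adj b c → G.Adj a c)
    (h : ∀ c x y, c ≠ a → G.Adj b c → x ≠ a → ¬ G.Adj a x → G.Adj x y → y = c ∨ G.Adj c y) :
    (insert a (G.neighborFinset a))ᶜ.card * (r - k) ≤ (r + k + 1) * (2 * k + 2) := by
  refine (Finset.card_mul_le_card_mul G.Adj (s := (insert a (G.neighborFinset a))ᶜ)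
    (t := insert c₀ (G.neighborFinset c₀)) (m := r - k) (n := 2 * k + 2) ?_ ?_).trans ?_
  · intro x hx
    simp only [Finset.mem_compl, Finset.mem_insert, SimpleGraph.mem_neighborFinset, not_or] at hx
    have hsub' : G.neighborFinset x ⊆
        Finset.bipartiteAbove G.Adj (insert c₀ (G.neighborFinset c₀)) x := by
      intro y hy
      simp only [SimpleGraph.mem_neighborFinset] at hy
      simp [Finset.mem_bipartiteAbove, hy, h c₀ x y hc₀a hc₀ hx.1 hx.2 hy]
    have := Finset.card_le_card hsub'
    rw [SimpleGraph.card_neighborFinset_eq_degree] at this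
    have := hlow x
    omega
  · intro y _
    set B := Finset.bipartiteBelow G.Adj (insert a (G.neighborFinset a))ᶜ y with hB
    rcases B.eq_empty_or_nonempty with he | ⟨x, hx⟩
    · simp [he]
    have hmem : ∀ z, z ∈ B ↔ (z ≠ a ∧ ¬ G.Adj a z) ∧ G.Adj z y := by
      intro z
      simp [hB, Finset.mem_bipartiteBelow]
    have hxB := (hmem x).1 hx
    set C := ((G.neighborFinset b).erase a).erase y with hC
    have hCmem : ∀ z, z ∈ C ↔ z ≠ y ∧ z ≠ a ∧ G.Adj b z := by
      intro z
      simp [hC]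
    have hdisj : Disjoint B C := by
      rw [Finset.disjoint_left]
      intro z hz hz'
      exact ((hmem z).1 hz).1.2 (hsub z ((hCmem z).1 hz').2.1 ((hCmem z).1 hz').2.2)
    have hunion : B ∪ C ⊆ G.neighborFinset y := by
      intro z hz
      rw [SimpleGraph.mem_neighborFinset]
      rcases Finset.mem_union.1 hz with hz | hz
      · exact ((hmem z).1 hz).2.symm
      · obtain ⟨h1, h2, h3⟩ := (hCmem z).1 hz
        rcases h z x y h2 h3 hxB.1.1 hxB.1.2 hxB.2 with h4 | h4
        · exact absurd h4.symm h1
        · exact h4.symm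
    have h1 := Finset.card_le_card hunion
    rw [Finset.card_union_of_disjoint hdisj, SimpleGraph.card_neighborFinset_eq_degree] at h1
    have h2 : (G.neighborFinset b).card - 1 ≤ ((G.neighborFinset b).erase a).card :=
      Finset.pred_card_le_card_erase
    have h3 : ((G.neighborFinset b).erase a).card - 1 ≤ C.card := Finset.pred_card_le_card_erase
    rw [SimpleGraph.card_neighborFinset_eq_degree] at h2
    have := hlow b
    have := hup y
    omega
  · gcongr
    refine (Finset.card_insert_le _ _).trans ?_
    rw [SimpleGraph.card_neighborFinset_eq_degree]
    have := hup c₀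
    omega

lemma le_card_nonneighbors {r k : ℕ} {a : V} (hup : ∀ v, G.degree v ≤ r + k) :
    Fintype.card V ≤ (insert a (G.neighborFinset a))ᶜ.card + r + k + 1 := by
  rw [Finset.card_compl]
  have h1 := Finset.card_insert_le a (G.neighborFinset a)
  rw [SimpleGraph.card_neighborFinset_eq_degree] at h1
  have := hup a
  omega

end Counting

/-- Every realization of a near-regular sequence is a single switch away from `Hset`. -/
lemma exists_switch_mem_Hset {n r k : ℕ} {d : Fin n → ℕ} {a b : Fin n} (hab : a ≠ b)
    (hr : 2 ≤ r) (hk : k * k < r) (hn : r + 9 * k + 13 < n)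
    (hlow : ∀ v, r ≤ d v + k) (hup : ∀ v, d v ≤ r + k)
    {G : SimpleGraph (Fin n)} (hG : G ∈ Gd n d) :
    ∃ p q x y, switch G p q x y ∈ Hset n d a b := by
  classical
  have hdeg : ∀ v, G.degree v = d v := fun v => by rw [← degOf_eq_degree]; exact hG v
  have hlow' : ∀ v, r ≤ G.degree v + k := fun v => by rw [hdeg]; exact hlow v
  have hup' : ∀ v, G.degree v ≤ r + k := fun v => by rw [hdeg]; exact hup v
  have hX := le_card_nonneighbors (a := a) hup'
  rw [Fintype.card_fin] at hX
  have hkr : k < r := by nlinarith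
  by_cases hH : ∃ c, c ≠ a ∧ c ≠ b ∧ G.Adj b c ∧ ¬ G.Adj a c
  · exact ⟨a, a, a, a, by rw [switch_self]; exact ⟨hG, hH⟩⟩
  push Not at hH
  have hsub : ∀ c, c ≠ a → G.Adj b c → G.Adj a c := fun c hc hbc => hH c hc hbc.ne' hbc
  by_contra hno
  push Not at hno
  by_cases hC : ∃ c, c ≠ a ∧ G.Adj b c
  · obtain ⟨c₀, hc₀a, hc₀⟩ := hC
    have key := card_nonneighbors_mul_le_of_dominating hlow' hup' hc₀ hc₀a hsub (by
      intro c x y hca hbc hxa hax hxy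
      by_contra hcy
      push Not at hcy
      have hac := hsub c hca hbc
      refine hno a c x y ⟨fun v => ?_, c, hca, hbc.ne', ?_, ?_⟩
      · rw [degOf_switch hac hxy hax hcy.2 hxa.symm hcy.1.symm]
        exact hG v
      · rw [switch_adj]
        simp only [Sym2.eq_iff]
        grind [SimpleGraph.adj_comm]
      · rw [switch_adj]
        simp [hac])
    set X := (insert a (G.neighborFinset a))ᶜ.card
    obtain ⟨m, rfl⟩ : ∃ m, r = k + m := ⟨r - k, by omega⟩
    rw [Nat.add_sub_cancel_left] at key
    have hm : k ≤ m := by nlinarith [sq_nonneg ((k : ℤ) - 1)]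
    have hm' : 1 ≤ m := by omega
    have h1 : 2 * k + m + 1 ≤ 4 * m := by omega
    have h2 : X * m ≤ 4 * m * (2 * k + 2) :=
      key.trans (Nat.mul_le_mul_right _ (by omega))
    have h3 : X ≤ 8 * k + 8 := by nlinarith
    omega
  · push Not at hC
    have hb : G.degree b ≤ 1 := by
      rw [← SimpleGraph.card_neighborFinset_eq_degree, Finset.card_le_one]
      have : ∀ z ∈ G.neighborFinset b, z = a := fun z hz => by
        by_contra hza
        exact hC z hza ((SimpleGraph.mem_neighborFinset _ _ _).1 hz)
      intro z hz w hw
      rw [this z hz, this w hw]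
    have hrk : r ≤ 1 + k := (hlow' b).trans (by omega)
    have hk1 : k = 1 := by
      have : k < 2 := by by_contra h; nlinarith
      omega
    have hr2 : r = 2 := by omega
    have hba : G.Adj b a := by
      have : 0 < G.degree b := by have := hlow' b; omega
      obtain ⟨z, hz⟩ := (G.degree_pos_iff_exists_adj b).1 this
      by_cases hza : z = a
      · rwa [← hza]
      · exact absurd hz (hC z hza)
    have key := card_nonneighbors_mul_le (a := a) hlow' hup' (by
      intro x y hxa hax hxy
      by_contra hay
      have hya : y ≠ a := by rintro rfl; exact hax hxy.symm
      have hyb : y ≠ b := by rintro rfl; exact hay hba.symm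
      have hxb : x ≠ b := by rintro rfl; exact hax hba.symm
      have hyx : y ≠ x := hxy.ne'
      have hby : ¬ G.Adj b y := hC y hya
      refine hno a b x y ⟨fun v => ?_, y, hya, hyb, ?_, ?_⟩
      · rw [degOf_switch hba.symm hxy hax hby hxa.symm hyb.symm]
        exact hG v
      · rw [switch_adj]
        simp [hby, hyb.symm]
      · rw [switch_adj]
        simp only [Sym2.eq_iff]
        grind)
    subst hk1 hr2
    omega

lemma ncard_Gd_le {n r k : ℕ} {d : Fin n → ℕ} {a b : Fin n} (hab : a ≠ b)
    (hr : 2 ≤ r) (hk : k * k < r) (hn : r + 9 * k + 13 < n)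
    (hlow : ∀ v, r ≤ d v + k) (hup : ∀ v, d v ≤ r + k) :
    (Gd n d).ncard ≤ n ^ 4 * (Hset n d a b).ncard := by
  have hsub : Gd n d ⊆ (fun t : (Fin n × Fin n × Fin n × Fin n) × SimpleGraph (Fin n) =>
      switch t.2 t.1.1 t.1.2.1 t.1.2.2.1 t.1.2.2.2) '' (Set.univ ×ˢ Hset n d a b) := by
    intro G hG
    obtain ⟨p, q, x, y, h⟩ := exists_switch_mem_Hset hab hr hk hn hlow hup hG
    exact ⟨((p, q, x, y), switch G p q x y), ⟨Set.mem_univ _, h⟩, switch_switch G p q x y⟩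
  refine (Set.ncard_le_ncard hsub (Set.toFinite _)).trans
    ((Set.ncard_image_le (Set.toFinite _)).trans ?_)
  rw [Set.ncard_prod, Set.ncard_univ]
  simp only [Nat.card_eq_fintype_card, Fintype.card_prod, Fintype.card_fin]
  exact le_of_eq (by ring)

/-- A real deviation bound `r ^ α` with `α < 1 / 2` can be replaced by a natural number `k` with
`k ^ 2 < r`. -/
lemma exists_nat_deviation {ι : Type*} {α : ℝ} (hα : α < 1 / 2) {r : ℕ} (hr : 2 ≤ r) {d : ι → ℕ}
    (hd : ∀ i, |(d i : ℝ) - (r : ℝ)| ≤ (r : ℝ) ^ α) :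
    ∃ k : ℕ, k * k < r ∧ (∀ i, r ≤ d i + k) ∧ ∀ i, d i ≤ r + k := by
  have hr1 : (1 : ℝ) < r := by exact_mod_cast hr
  have hr0 : (0 : ℝ) < r := by linarith
  have hpos : (0 : ℝ) ≤ (r : ℝ) ^ α := by positivity
  refine ⟨⌊(r : ℝ) ^ α⌋₊, ?_, fun i => ?_, fun i => ?_⟩
  · have hfl := Nat.floor_le hpos
    have hlt : (r : ℝ) ^ α * (r : ℝ) ^ α < r := by
      rw [← Real.rpow_add hr0]
      calc (r : ℝ) ^ (α + α) < (r : ℝ) ^ (1 : ℝ) :=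
            Real.rpow_lt_rpow_of_exponent_lt hr1 (by linarith)
        _ = r := Real.rpow_one _
    have : ((⌊(r : ℝ) ^ α⌋₊ : ℕ) : ℝ) * (⌊(r : ℝ) ^ α⌋₊ : ℕ) < r :=
      (mul_le_mul hfl hfl (Nat.cast_nonneg _) hpos).trans_lt hlt
    exact_mod_cast this
  · have h := (abs_le.1 (hd i)).1
    have : r - d i ≤ ⌊(r : ℝ) ^ α⌋₊ := by
      rcases le_total r (d i) with hle | hle
      · simp [Nat.sub_eq_zero_of_le hle]
      · apply Nat.le_floor
        rw [Nat.cast_sub hle]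
        linarith
    omega
  · have h := (abs_le.1 (hd i)).2
    have : d i - r ≤ ⌊(r : ℝ) ^ α⌋₊ := by
      rcases le_total (d i) r with hle | hle
      · simp [Nat.sub_eq_zero_of_le hle]
      · apply Nat.le_floor
        rw [Nat.cast_sub hle]
        linarith
    omega

/-- For near-regular degree sequences, the hinge-flippable realizations form at least a
`1/n¹²` fraction of all realizations: `n¹² · |H| ≥ |G(d)|`. -/
theorem Hset_large (α ρ : ℝ) (hα0 : 0 < α) (hα : α < 1 / 2)
    (hρ0 : 0 < ρ) (hρ : ρ < 1) :
    ∃ n₀ : ℕ, ∀ n : ℕ, n₀ ≤ n → ∀ r : ℕ, 2 ≤ r → (r : ℝ) ≤ (1 - ρ) * n →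
      ∀ d : Fin n → ℕ, (∀ i, |(d i : ℝ) - (r : ℝ)| ≤ (r : ℝ) ^ α) →
        ∀ a b : Fin n, a ≠ b →
          n ^ 12 * (Hset n d a b).ncard ≥ (Gd n d).ncard := by
  obtain ⟨n₀, hn₀⟩ := exists_nat_gt (1000 / ρ ^ 2)
  refine ⟨n₀, fun n hn r hr hrn d hd a b hab => ?_⟩
  obtain ⟨k, hk, hlow, hup⟩ := exists_nat_deviation hα hr hd
  have hnρ : 1000 < ρ * (ρ * n) := by
    have : (n₀ : ℝ) ≤ n := by exact_mod_cast hn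
    have := (div_lt_iff₀ (by positivity)).1 (hn₀.trans_le this)
    linarith
  have hn0 : (0 : ℝ) < n := by
    by_contra h
    nlinarith [mul_pos hρ0 hρ0]
  have hkn : (k : ℝ) * k < n := by
    have : (k : ℝ) * k < r := by exact_mod_cast hk
    nlinarith
  have hgap : 9 * (k : ℝ) + 13 < ρ * n := by
    have hsq : 1000 * (n : ℝ) < (ρ * n) * (ρ * n) := by nlinarith
    have hone : (1 : ℝ) ≤ n := by exact_mod_cast Nat.cast_pos.1 hn0
    by_contra h
    push Not at h
    have : (ρ * n) * (ρ * n) ≤ (9 * (k : ℝ) + 13) * (9 * (k : ℝ) + 13) :=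
      mul_self_le_mul_self (by positivity) h
    nlinarith [sq_nonneg ((k : ℝ) - 1)]
  have hlarge : r + 9 * k + 13 < n := by
    have : (r : ℝ) + 9 * k + 13 < n := by linarith
    exact_mod_cast this
  refine (ncard_Gd_le hab hr hk hlarge hlow hup).trans ?_
  gcongr
  · omega
  · norm_num
end
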